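/- Let P be a DPAG that contains a directed mixed graph G, and let i ≠ j be two nodes with a directed edge i → j in P. Suppose there is no inducing walk between i and j in G that is both into i and into j, and suppose that for every vertex k such that there is a possibly directed path ⟨i, k, j⟩ of length two from i to j in P, the edge k → j is definitely visible in the DPAG P* obtained from P by replacing the edge between k and j by k → j. Then the directed edge i → j is present in G. -/

import Mathlib

namespace CausalGraphs

variable {V : Type*}

/-- A directed mixed graph (DMG): directed edges `dir` (`i → j`) and
bidirected edges `bi` (`i ↔ j`), with no self-loops. -/
structure DMG (V : Type*) where
  dir : V → V → Prop
  bi : V → V → Prop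
  dir_irrefl : ∀ i, ¬ dir i i
  bi_irrefl : ∀ i, ¬ bi i i

namespace DMG

/-- `G.Anc i j`: `i ∈ an(G, j)`, i.e. there is a (possibly trivial) directed path
from `i` to `j` in `G`. -/
def Anc (G : DMG V) (i j : V) : Prop :=
  Relation.ReflTransGen G.dir i j

/-- `G.Scc i j`: `i ∈ scc(G, j)`, i.e. `i` and `j` lie in the same strongly
connected component of `G`. -/
def Scc (G : DMG V) (i j : V) : Prop :=
  G.Anc i j ∧ G.Anc j i

/-- There is a bidirected edge between `i` and `j` (bidirected edges are unordered). -/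
def BiEdge (G : DMG V) (i j : V) : Prop :=
  G.bi i j ∨ G.bi j i

/-- `G` has no directed cycle (i.e. `G` is an ADMG). -/
def Acyclic (G : DMG V) : Prop :=
  ∀ i j, G.dir i j → ¬ G.Anc j i

end DMG

/-- A walk of length `len` is recorded by its vertices `vert 0, …, vert len` and,
for each edge index `k < len`, the edge marks: `intoL k` (resp. `intoR k`) is `true`
iff the `k`-th edge has an arrowhead at `vert k` (resp. at `vert (k+1)`). -/
structure Walk (V : Type*) where
  len : ℕ
  vert : ℕ → V
  intoL : ℕ → Bool
  intoR : ℕ → Bool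

namespace Walk

def first (w : Walk V) : V := w.vert 0

def last (w : Walk V) : V := w.vert w.len

/-- The walk is an actual walk in a DMG `G`: each step traverses a directed edge
(in either direction) or a bidirected edge of `G`, with the corresponding marks. -/
def ValidOn (G : DMG V) (w : Walk V) : Prop :=
  ∀ k, k < w.len →
    (w.intoL k = false ∧ w.intoR k = true ∧ G.dir (w.vert k) (w.vert (k+1))) ∨
    (w.intoL k = true ∧ w.intoR k = false ∧ G.dir (w.vert (k+1)) (w.vert k)) ∨
    (w.intoL k = true ∧ w.intoR k = true ∧ G.BiEdge (w.vert k) (w.vert (k+1)))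

/-- `k` is a non-endpoint position of the walk. -/
def Interior (w : Walk V) (k : ℕ) : Prop := 0 < k ∧ k < w.len

/-- The non-endpoint node `vert k` is a collider on the walk: both adjacent
edges have an arrowhead at it. -/
def ColliderAt (w : Walk V) (k : ℕ) : Prop :=
  w.Interior k ∧ w.intoR (k-1) = true ∧ w.intoL k = true

/-- The non-endpoint node `vert k` is a non-collider on the walk. -/
def NonColliderAt (w : Walk V) (k : ℕ) : Prop :=
  w.Interior k ∧ ¬ (w.intoR (k-1) = true ∧ w.intoL k = true)

/-- The edge on the first-endpoint side of position `k` is directed out of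
`vert k`, pointing to the neighbour `vert (k-1)` on the walk. -/
def PointsLeft (w : Walk V) (k : ℕ) : Prop :=
  w.intoL (k-1) = true ∧ w.intoR (k-1) = false

/-- The edge on the last-endpoint side of position `k` is directed out of
`vert k`, pointing to the neighbour `vert (k+1)` on the walk. -/
def PointsRight (w : Walk V) (k : ℕ) : Prop :=
  w.intoL k = false ∧ w.intoR k = true

/-- The walk is a path: all its vertices are distinct. -/
def IsPath (w : Walk V) : Prop :=
  ∀ a, a ≤ w.len → ∀ b, b ≤ w.len → w.vert a = w.vert b → a = b

/-- The walk is into its first node (arrowhead at the first node). -/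
def IntoFirst (w : Walk V) : Prop := 0 < w.len ∧ w.intoL 0 = true

/-- The walk is into its last node (arrowhead at the last node). -/
def IntoLast (w : Walk V) : Prop := 0 < w.len ∧ w.intoR (w.len - 1) = true

/-- The walk is σ-blocked by the set `C`. -/
def SigmaBlocked (G : DMG V) (w : Walk V) (C : Set V) : Prop :=
  w.first ∈ C ∨ w.last ∈ C ∨
  (∃ k, w.ColliderAt k ∧ ¬ ∃ c ∈ C, G.Anc (w.vert k) c) ∨
  (∃ k, w.NonColliderAt k ∧ w.vert k ∈ C ∧
    ((w.PointsLeft k ∧ ¬ G.Scc (w.vert k) (w.vert (k-1))) ∨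
     (w.PointsRight k ∧ ¬ G.Scc (w.vert k) (w.vert (k+1)))))

/-- The walk is d-blocked by the set `C`. -/
def DBlocked (G : DMG V) (w : Walk V) (C : Set V) : Prop :=
  w.first ∈ C ∨ w.last ∈ C ∨
  (∃ k, w.ColliderAt k ∧ ¬ ∃ c ∈ C, G.Anc (w.vert k) c) ∨
  (∃ k, w.NonColliderAt k ∧ w.vert k ∈ C)

/-- The walk is inducing: every collider on it is an ancestor of one of the two
endpoints, and every non-endpoint non-collider only has outgoing directed edges
to its neighbours on the walk that lie in the same strongly connected component. -/
def Inducing (G : DMG V) (w : Walk V) : Prop :=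
  (∀ k, w.ColliderAt k → G.Anc (w.vert k) w.first ∨ G.Anc (w.vert k) w.last) ∧
  (∀ k, w.NonColliderAt k →
    (w.PointsLeft k → G.Scc (w.vert k) (w.vert (k-1))) ∧
    (w.PointsRight k → G.Scc (w.vert k) (w.vert (k+1))))

end Walk

namespace DMG

/-- `A` and `B` are σ-separated given `C` in `G`. -/
def SigmaSep (G : DMG V) (A B C : Set V) : Prop :=
  ∀ w : Walk V, w.ValidOn G → w.first ∈ A → w.last ∈ B → w.SigmaBlocked G C

/-- `A` and `B` are d-separated given `C` in `G`. -/
def DSep (G : DMG V) (A B C : Set V) : Prop :=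
  ∀ w : Walk V, w.ValidOn G → w.first ∈ A → w.last ∈ B → w.DBlocked G C

/-- Nodes `i` and `j` are σ-connected given `C` in `G`. -/
def SigmaConnected (G : DMG V) (i j : V) (C : Set V) : Prop :=
  ∃ w : Walk V, w.ValidOn G ∧ w.first = i ∧ w.last = j ∧ ¬ w.SigmaBlocked G C

/-- The σ-independence model of `G`. -/
def IMsigma (G : DMG V) : Set (Set V × Set V × Set V) :=
  { t | G.SigmaSep t.1 t.2.1 t.2.2 }

/-- The d-independence model of `G`. -/
def IMd (G : DMG V) : Set (Set V × Set V × Set V) :=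
  { t | G.DSep t.1 t.2.1 t.2.2 }

/-- There is an inducing walk between `i` and `j` in `G`. -/
def InducingWalk (G : DMG V) (i j : V) : Prop :=
  ∃ w : Walk V, w.ValidOn G ∧ w.first = i ∧ w.last = j ∧ w.Inducing G

/-- There is an inducing path between `i` and `j` in `G`. -/
def InducingPath (G : DMG V) (i j : V) : Prop :=
  ∃ w : Walk V, w.ValidOn G ∧ w.first = i ∧ w.last = j ∧ w.IsPath ∧ w.Inducing G

/-- There is an inducing walk between `i` and `j` in `G` that is into `j`. -/
def InducingWalkIntoLast (G : DMG V) (i j : V) : Prop :=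
  ∃ w : Walk V, w.ValidOn G ∧ w.first = i ∧ w.last = j ∧ w.Inducing G ∧ w.IntoLast

/-- There is an inducing walk between `i` and `j` in `G` that is into both `i` and `j`. -/
def InducingWalkIntoBoth (G : DMG V) (i j : V) : Prop :=
  ∃ w : Walk V, w.ValidOn G ∧ w.first = i ∧ w.last = j ∧ w.Inducing G ∧ w.IntoFirst ∧ w.IntoLast

/-- `G'` is an acyclification of `G`. -/
def IsAcyclification (G G' : DMG V) : Prop :=
  G'.Acyclic ∧
  (∀ i j, ¬ G.Scc i j →
    ((G'.dir i j ↔ ∃ k, G.Scc k j ∧ G.dir i k) ∧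
     (G'.bi i j ↔ ∃ k, G.Scc k j ∧ G.bi i k))) ∧
  (∀ i j, i ≠ j → G.Scc i j → (G'.dir i j ∨ G'.dir j i ∨ G'.bi i j))

end DMG

/-- Edge marks of a partial ancestral graph. -/
inductive Mark : Type
  | tail
  | arrow
  | circle
deriving DecidableEq

/-- A directed partial ancestral graph (DPAG). `mark i j` is the edge mark at `j`
on the edge between `i` and `j` (only meaningful when `adj i j`). Allowed edge
types are `→`, `←`, `↔`, `∘→`, `←∘` and `∘—∘`; there are no directed and no
almost directed cycles. -/
structure DPAG (V : Type*) where
  adj : V → V → Prop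
  mark : V → V → Mark
  adj_symm : ∀ i j, adj i j → adj j i
  adj_irrefl : ∀ i, ¬ adj i i
  tail_imp_arrow : ∀ i j, adj i j → mark j i = Mark.tail → mark i j = Mark.arrow
  no_directed_cycle : ∀ i, ¬ Relation.TransGen
    (fun a b => adj a b ∧ mark a b = Mark.arrow ∧ mark b a = Mark.tail) i i
  no_almost_directed_cycle : ∀ i j, Relation.ReflTransGen
    (fun a b => adj a b ∧ mark a b = Mark.arrow ∧ mark b a = Mark.tail) i j →
    ¬ (adj i j ∧ mark i j = Mark.arrow ∧ mark j i = Mark.arrow)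

/-- A directed edge `i → j` with respect to raw adjacency/mark data. -/
def DirEdgeOn (adj : V → V → Prop) (mark : V → V → Mark) (i j : V) : Prop :=
  adj i j ∧ mark i j = Mark.arrow ∧ mark j i = Mark.tail

/-- The directed edge `i → j` is definitely visible, with respect to raw
adjacency/mark data: there is a node `k` not adjacent to `j` such that either
the edge between `k` and `i` is into `i`, or there is a path between `k` and `i`
that is into `i` on which every non-endpoint node is a collider and a parent of `j`. -/
def DefinitelyVisibleOn (adj : V → V → Prop) (mark : V → V → Mark) (i j : V) : Prop :=
  DirEdgeOn adj mark i j ∧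
  ∃ k, ¬ adj k j ∧
    ((adj k i ∧ mark k i = Mark.arrow) ∨
     (∃ n, ∃ p : ℕ → V, 0 < n ∧ p 0 = k ∧ p n = i ∧
       (∀ a, a ≤ n → ∀ b, b ≤ n → p a = p b → a = b) ∧
       (∀ m, m < n → adj (p m) (p (m+1))) ∧
       mark (p (n-1)) i = Mark.arrow ∧
       (∀ m, 0 < m → m < n →
         (mark (p (m-1)) (p m) = Mark.arrow ∧ mark (p (m+1)) (p m) = Mark.arrow) ∧
         DirEdgeOn adj mark (p m) j)))

namespace DPAG

/-- `i → j` in `P`. -/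
def DirEdge (P : DPAG V) (i j : V) : Prop := DirEdgeOn P.adj P.mark i j

/-- `i ↔ j` in `P`. -/
def BiEdge (P : DPAG V) (i j : V) : Prop :=
  P.adj i j ∧ P.mark i j = Mark.arrow ∧ P.mark j i = Mark.arrow

/-- `i *→ j` in `P`: an edge between `i` and `j` with an arrowhead at `j`. -/
def ArrowAt (P : DPAG V) (i j : V) : Prop := P.adj i j ∧ P.mark i j = Mark.arrow

/-- The directed edge `i → j` of `P` is definitely visible in `P`. -/
def DefinitelyVisible (P : DPAG V) (i j : V) : Prop :=
  DefinitelyVisibleOn P.adj P.mark i j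

/-- The DPAG `P` contains the DMG `G`. -/
def Contains (P : DPAG V) (G : DMG V) : Prop :=
  (∀ i j, i ≠ j → (P.adj i j ↔ G.InducingPath i j)) ∧
  (∀ i j, P.ArrowAt i j → ¬ G.Anc j i) ∧
  (∀ i j, P.DirEdge i j → G.Anc i j)

/-- `p 0, …, p n` is a possibly directed path in `P`: consecutive vertices are
adjacent, no edge has an arrowhead at the endpoint nearer `p 0`, and all
vertices are distinct. -/
def PossiblyDirectedPathOn (P : DPAG V) (n : ℕ) (p : ℕ → V) : Prop :=
  (∀ k, k < n → P.adj (p k) (p (k+1)) ∧ P.mark (p (k+1)) (p k) ≠ Mark.arrow) ∧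
  (∀ a, a ≤ n → ∀ b, b ≤ n → p a = p b → a = b)

/-- The path `p 0, …, p n` is uncovered: every consecutive triple is unshielded. -/
def UncoveredOn (P : DPAG V) (n : ℕ) (p : ℕ → V) : Prop :=
  ∀ k, k + 2 ≤ n → ¬ P.adj (p k) (p (k+2))

/-- There is a possibly directed path from `i` to `j` in `P`. -/
def PDPath (P : DPAG V) (i j : V) : Prop :=
  ∃ n, ∃ p : ℕ → V, p 0 = i ∧ p n = j ∧ P.PossiblyDirectedPathOn n p

end DPAG

/-- JCI Assumption 1 (exogeneity): no system variable causes any context variable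
(`K` is the set of context nodes; its complement is the set of system nodes). -/
def JCI1 (G : DMG V) (K : Set V) : Prop :=
  ∀ i k, i ∉ K → k ∈ K → ¬ G.dir i k

/-- JCI Assumption 2 (randomization): no pair of a system and a context variable
is confounded. -/
def JCI2 (G : DMG V) (K : Set V) : Prop :=
  ∀ i k, i ∉ K → k ∈ K → ¬ G.BiEdge i k

/-- JCI Assumption 3 (genericity): every pair of distinct context variables is
connected by a bidirected edge and by no directed edge. -/
def JCI3 (G : DMG V) (K : Set V) : Prop :=
  ∀ k k', k ∈ K → k' ∈ K → k ≠ k' → (G.bi k k' ∧ ¬ G.dir k k')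

/-- An independence model on `V`: a set of triples of subsets of `V`. -/
abbrev IndepModel (V : Type*) := Set (Set V × Set V × Set V)

/-- Background knowledge `Ψ` is compatible with the acyclification. -/
def CompatibleWithAcyclification (Ψ : DMG V → Prop) : Prop :=
  ∀ G : DMG V, Ψ G →
    (∃ G', G.IsAcyclification G' ∧ Ψ G') ∧
    (∀ i j : V, G.Anc i j → ∃ G', G.IsAcyclification G' ∧ Ψ G' ∧ G'.Anc i j) ∧
    (∀ i j : V, ¬ G.Anc i j → ∀ G', G.IsAcyclification G' → Ψ G' → ¬ G'.Anc i j)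

/-- The mark at an end of an edge of a DMG; tails are split according to whether the
edge stays inside a strongly connected component. -/
inductive EndMark : Type
  | arrow
  | sccTail
  | tail

namespace DMG

variable {G : DMG V}

theorem Anc.trans {a b c : V} (h : G.Anc a b) (h' : G.Anc b c) : G.Anc a c :=
  Relation.ReflTransGen.trans h h'

theorem Anc.of_dir {a b : V} (h : G.dir a b) : G.Anc a b :=
  Relation.ReflTransGen.single h

/-- `v` is an ancestor of `i` or of `j`. -/
def AncEither (G : DMG V) (i j v : V) : Prop := G.Anc v i ∨ G.Anc v j

/-- An edge of `G` between `u` and `v` with marks `l` at `u` and `r` at `v`. -/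
inductive MarkedEdge (G : DMG V) (u : V) : EndMark → V → EndMark → Prop
  | out {v} : G.dir u v → MarkedEdge G u .tail v .arrow
  | outScc {v} : G.dir u v → G.Scc u v → MarkedEdge G u .sccTail v .arrow
  | inn {v} : G.dir v u → MarkedEdge G u .arrow v .tail
  | innScc {v} : G.dir v u → G.Scc v u → MarkedEdge G u .arrow v .sccTail
  | bi {v} : G.BiEdge u v → MarkedEdge G u .arrow v .arrow

/-- The adjacent marks `r` and `l` at an interior node `v` of an inducing walk are allowed,
where colliders have to satisfy `A`. -/
def InteriorOk (A : V → Prop) (v : V) (r l : EndMark) : Prop :=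
  r ≠ .tail ∧ l ≠ .tail ∧ (r = .arrow → l = .arrow → A v)

/-- There is a nontrivial walk from `u` to `v`, with mark `l` at `u` and `r` at `v`, on which
every collider satisfies `A` and every other interior node only has outgoing edges to
neighbours in its strongly connected component. -/
inductive MarkedWalk (G : DMG V) (A : V → Prop) : V → EndMark → V → EndMark → Prop
  | single {u l v r} : G.MarkedEdge u l v r → MarkedWalk G A u l v r
  | cons {u l v r l' w r'} : G.MarkedEdge u l v r → InteriorOk A v r l' →
      MarkedWalk G A v l' w r' → MarkedWalk G A u l w r'

theorem MarkedEdge.symm {u v : V} {l r : EndMark} (h : G.MarkedEdge u l v r) :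
    G.MarkedEdge v r u l := by
  cases h with
  | out h => exact .inn h
  | outScc h h' => exact .innScc h h'
  | inn h => exact .out h
  | innScc h h' => exact .outScc h h'
  | bi h => exact .bi h.symm

theorem MarkedEdge.dir_of_ne_arrow {u v : V} {l r : EndMark} (h : G.MarkedEdge u l v r)
    (hl : l ≠ .arrow) : G.dir u v ∧ r = .arrow := by
  cases h <;> simp_all

theorem MarkedEdge.scc {u v : V} {r : EndMark} (h : G.MarkedEdge u .sccTail v r) :
    G.Scc u v := by
  cases h; assumption

theorem InteriorOk.symm {A : V → Prop} {v : V} {r l : EndMark} (h : InteriorOk A v r l) :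
    InteriorOk A v l r :=
  ⟨h.2.1, h.1, fun a b => h.2.2 b a⟩

theorem InteriorOk.of_sccTail {A : V → Prop} {v : V} {l : EndMark} (h : l ≠ .tail) :
    InteriorOk A v .sccTail l :=
  ⟨by simp, h, by simp⟩

theorem InteriorOk.of_arrow {A : V → Prop} {v : V} (h : A v) :
    InteriorOk A v .arrow .arrow :=
  ⟨by simp, by simp, fun _ _ => h⟩

variable {A : V → Prop}

theorem MarkedWalk.append {u v w : V} {l r l' r' : EndMark} (h : G.MarkedWalk A u l v r)
    (hv : InteriorOk A v r l') (h' : G.MarkedWalk A v l' w r') : G.MarkedWalk A u l w r' := by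
  induction h with
  | single e => exact .cons e hv h'
  | cons e ok _ ih => exact .cons e ok (ih hv h')

theorem MarkedWalk.symm {u v : V} {l r : EndMark} (h : G.MarkedWalk A u l v r) :
    G.MarkedWalk A v r u l := by
  induction h with
  | single e => exact .single e.symm
  | cons e ok _ ih => exact ih.append ok.symm (.single e.symm)

theorem MarkedWalk.mono {B : V → Prop} (hAB : ∀ c, A c → B c) {u v : V} {l r : EndMark}
    (h : G.MarkedWalk A u l v r) : G.MarkedWalk B u l v r := by
  induction h with
  | single e => exact .single e
  | cons e ok _ ih => exact .cons e ⟨ok.1, ok.2.1, fun a b => hAB _ (ok.2.2 a b)⟩ ih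

/-- A directed path inside a strongly connected component, traversed backwards. -/
theorem MarkedWalk.of_scc {u v : V} (h : G.Scc u v) (hne : v ≠ u) :
    G.MarkedWalk A u .arrow v .sccTail := by
  obtain ⟨huv, hvu⟩ := h
  have ht := (Relation.reflTransGen_iff_eq_or_transGen.1 hvu).resolve_left (Ne.symm hne)
  clear hvu hne
  induction ht using Relation.TransGen.head_induction_on with
  | single hd => exact .single (.innScc hd ⟨.of_dir hd, huv⟩)
  | head hd ht ih =>
    have hc := huv.trans (.of_dir hd)
    exact (ih hc).append (.of_sccTail (by simp))
      (.single (.innScc hd ⟨.of_dir hd, ht.to_reflTransGen.trans huv⟩))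

/-- Following the tails from the start of a walk leads to its end or to a collider. -/
theorem MarkedWalk.anc_of_ne_arrow {u w : V} {l r : EndMark} (h : G.MarkedWalk A u l w r)
    (hl : l ≠ .arrow) : G.Anc u w ∨ ∃ c, G.Anc u c ∧ A c := by
  induction h with
  | single e => exact .inl (.of_dir (e.dir_of_ne_arrow hl).1)
  | @cons u l v r l' w r' e ok _ ih =>
    obtain ⟨hd, hr⟩ := e.dir_of_ne_arrow hl
    by_cases hl' : l' = .arrow
    · exact .inr ⟨v, .of_dir hd, ok.2.2 hr hl'⟩
    · rcases ih hl' with h | ⟨c, h, hc⟩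
      · exact .inl ((Anc.of_dir hd).trans h)
      · exact .inr ⟨c, (Anc.of_dir hd).trans h, hc⟩

theorem ne_of_dir {u v : V} (h : G.dir u v) : v ≠ u := by
  rintro rfl; exact G.dir_irrefl _ h

/-- The first edge of a walk can be replaced by a walk inside the strongly connected component
of the first node, so that the walk is into its first node. -/
theorem MarkedWalk.exists_arrow {u w : V} {l r : EndMark} (h : G.MarkedWalk A u l w r)
    (hl : l ≠ .tail) : ∃ r', G.MarkedWalk A u .arrow w r' := by
  cases l with
  | arrow => exact ⟨r, h⟩
  | tail => exact absurd rfl hl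
  | sccTail =>
    cases h with
    | single e =>
      exact ⟨_, .of_scc e.scc (ne_of_dir (e.dir_of_ne_arrow (by simp)).1)⟩
    | cons e ok tl =>
      exact ⟨r, (MarkedWalk.of_scc e.scc (ne_of_dir (e.dir_of_ne_arrow (by simp)).1)).append
        (.of_sccTail ok.2.1) tl⟩

/-- An inducing walk from a node that is not an ancestor of the other endpoint can be modified
so that it is into that node. -/
theorem MarkedWalk.arrow_of_not_anc {u w : V} {l r : EndMark}
    (h : G.MarkedWalk (G.AncEither u w) u l w r) (hn : ¬ G.Anc u w) :
    G.MarkedWalk (G.AncEither u w) u .arrow w r := by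
  by_cases hl : l = .arrow
  · exact hl ▸ h
  cases h with
  | single e => exact absurd (.of_dir (e.dir_of_ne_arrow hl).1) hn
  | @cons _ _ v r l' _ _ e ok h' =>
    obtain ⟨hd, hr⟩ := e.dir_of_ne_arrow hl
    have key : ∀ c, G.Anc v c → G.AncEither u w c → G.Anc v u := fun c hvc hc =>
      hc.elim (fun h => hvc.trans h) fun h => absurd ((Anc.of_dir hd).trans (hvc.trans h)) hn
    have hvu : G.Anc v u := by
      by_cases hl' : l' = .arrow
      · exact key v .refl (ok.2.2 hr hl')
      · rcases h'.anc_of_ne_arrow hl' with h | ⟨c, h, hc⟩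
        · exact absurd ((Anc.of_dir hd).trans h) hn
        · exact key c h hc
    exact (MarkedWalk.of_scc ⟨.of_dir hd, hvu⟩ (ne_of_dir hd)).append (.of_sccTail ok.2.1) h'

theorem AncEither.symm {i j v : V} (h : G.AncEither i j v) : G.AncEither j i v := Or.symm h

theorem MarkedWalk.arrow_right_of_not_anc {u w : V} {l r : EndMark}
    (h : G.MarkedWalk (G.AncEither u w) u l w r) (hn : ¬ G.Anc w u) :
    G.MarkedWalk (G.AncEither u w) u l w .arrow :=
  ((h.symm.mono fun _ => AncEither.symm).arrow_of_not_anc hn).symm.mono fun _ => AncEither.symm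

end DMG

namespace Walk

variable {G : DMG V}

/-- The interior nodes of the walk are as on an inducing walk, with `A` in place of the set of
ancestors of the endpoints. -/
def InteriorInducing (G : DMG V) (A : V → Prop) (w : Walk V) : Prop :=
  ∀ k, 0 < k → k < w.len →
    (w.intoR (k - 1) = true → w.intoL k = true → A (w.vert k)) ∧
    (w.intoR (k - 1) = false → G.Scc (w.vert k) (w.vert (k - 1))) ∧
    (w.intoL k = false → G.Scc (w.vert k) (w.vert (k + 1)))

theorem ValidOn.not_false_false {w : Walk V} (h : w.ValidOn G) {k : ℕ} (hk : k < w.len) :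
    (w.intoL k = false → w.intoR k = true) ∧ (w.intoR k = false → w.intoL k = true) := by
  rcases h k hk with h | h | h <;> simp [h]

theorem ValidOn.inducing_iff {w : Walk V} (h : w.ValidOn G) :
    w.Inducing G ↔ w.InteriorInducing G (G.AncEither w.first w.last) := by
  constructor
  · rintro ⟨hc, hn⟩ k hk0 hk
    refine ⟨fun hr hl => hc k ⟨⟨hk0, hk⟩, hr, hl⟩, fun hr => ?_, fun hl => ?_⟩
    · exact (hn k ⟨⟨hk0, hk⟩, by simp [hr]⟩).1
        ⟨(h.not_false_false (by omega)).2 hr, hr⟩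
    · exact (hn k ⟨⟨hk0, hk⟩, by simp [hl]⟩).2 ⟨hl, (h.not_false_false hk).1 hl⟩
  · intro hi
    refine ⟨fun k hk => (hi k hk.1.1 hk.1.2).1 hk.2.1 hk.2.2, fun k hk => ⟨?_, ?_⟩⟩
    · exact fun hp => (hi k hk.1.1 hk.1.2).2.1 hp.2
    · exact fun hp => (hi k hk.1.1 hk.1.2).2.2 hp.1

/-- The walk obtained by removing the part between the positions `a` and `b`. -/
def cut (w : Walk V) (a b : ℕ) : Walk V where
  len := w.len - (b - a)
  vert t := if t ≤ a then w.vert t else w.vert (t + (b - a))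
  intoL t := if t < a then w.intoL t else w.intoL (t + (b - a))
  intoR t := if t < a then w.intoR t else w.intoR (t + (b - a))

theorem cut_vert_of_le {w : Walk V} {a b t : ℕ} (ht : t ≤ a) :
    (w.cut a b).vert t = w.vert t := by simp [cut, ht]

theorem cut_vert_of_ge {w : Walk V} {a b t : ℕ} (hab : a < b) (he : w.vert a = w.vert b)
    (ht : a ≤ t) : (w.cut a b).vert t = w.vert (t + (b - a)) := by
  rcases ht.eq_or_lt with rfl | ht
  · rw [cut_vert_of_le le_rfl, he]; congr 1; omega
  · simp [cut, Nat.not_le.2 ht]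

theorem cut_into_of_lt {w : Walk V} {a b t : ℕ} (ht : t < a) :
    (w.cut a b).intoL t = w.intoL t ∧ (w.cut a b).intoR t = w.intoR t := by simp [cut, ht]

theorem cut_into_of_ge {w : Walk V} {a b t : ℕ} (ht : a ≤ t) :
    (w.cut a b).intoL t = w.intoL (t + (b - a)) ∧
      (w.cut a b).intoR t = w.intoR (t + (b - a)) := by simp [cut, Nat.not_lt.2 ht]

theorem ValidOn.cut {w : Walk V} (h : w.ValidOn G) {a b : ℕ} (hab : a < b)
    (he : w.vert a = w.vert b) : (w.cut a b).ValidOn G := by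
  intro k hk
  have hk' : k < w.len - (b - a) := hk
  rcases lt_or_ge k a with hka | hka
  · rw [cut_vert_of_le hka.le, cut_vert_of_le hka, (cut_into_of_lt hka).1, (cut_into_of_lt hka).2]
    exact h k (by omega)
  · rw [cut_vert_of_ge hab he hka, cut_vert_of_ge hab he (Nat.le_succ_of_le hka),
      (cut_into_of_ge hka).1, (cut_into_of_ge hka).2,
      show k + 1 + (b - a) = k + (b - a) + 1 by omega]
    exact h _ (by omega)

/-- If the edge before position `c` is into it and the edge after a later position `b` is into
that position, then there is a collider between `c` and `b` that descends from `vert c`, so every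
ancestor of `vert c` satisfies `A`. -/
theorem InteriorInducing.of_loop {A : V → Prop} (hA : ∀ c d, G.Anc c d → A d → A c)
    {w : Walk V} (h : w.ValidOn G) (hi : w.InteriorInducing G A) {b : ℕ} (hb : b < w.len)
    (hbl : w.intoL b = true) {v : V} (d : ℕ) : ∀ c, c + d = b → 0 < c →
      w.intoR (c - 1) = true → G.Anc v (w.vert c) → A v := by
  induction d with
  | zero =>
    intro c hc hc0 hr hv
    obtain rfl : c = b := hc
    exact hA _ _ hv ((hi c hc0 hb).1 hr hbl)
  | succ d ih =>
    intro c hc hc0 hr hv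
    cases hl : w.intoL c with
    | true => exact hA _ _ hv ((hi c hc0 (by omega)).1 hr hl)
    | false =>
      rcases h c (by omega) with h' | h' | h'
      · exact ih (c + 1) (by omega) (by omega) h'.2.1 (hv.trans (.of_dir h'.2.2))
      · simp [hl] at h'
      · simp [hl] at h'

theorem InteriorInducing.cut {A : V → Prop} (hA : ∀ c d, G.Anc c d → A d → A c)
    {w : Walk V} (h : w.ValidOn G) (hi : w.InteriorInducing G A) {a b : ℕ} (hab : a < b)
    (he : w.vert a = w.vert b) : (w.cut a b).InteriorInducing G A := by
  intro k hk0 hk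
  have hk' : k < w.len - (b - a) := hk
  rcases lt_trichotomy k a with hka | rfl | hka
  · rw [cut_vert_of_le hka.le, cut_vert_of_le hka, cut_vert_of_le (show k - 1 ≤ a by omega),
      (cut_into_of_lt hka).1, (cut_into_of_lt (show k - 1 < a by omega)).2]
    exact hi k hk0 (by omega)
  · have hb : k + (b - k) = b := by omega
    rw [cut_vert_of_le le_rfl, cut_vert_of_ge hab he (Nat.le_succ k),
      cut_vert_of_le (show k - 1 ≤ k by omega),
      (cut_into_of_ge le_rfl).1, (cut_into_of_lt (show k - 1 < k by omega)).2,
      show k + 1 + (b - k) = b + 1 by omega, hb]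
    refine ⟨fun hr hl => ?_, (hi k hk0 (by omega)).2.1, fun hl => ?_⟩
    · exact hi.of_loop hA h (by omega) hl (b - k) k hb hk0 hr .refl
    · rw [he]; exact (hi b (by omega) (by omega)).2.2 hl
  · rw [cut_vert_of_ge hab he hka.le, cut_vert_of_ge hab he (show a ≤ k + 1 by omega),
      cut_vert_of_ge hab he (show a ≤ k - 1 by omega),
      (cut_into_of_ge hka.le).1, (cut_into_of_ge (show a ≤ k - 1 by omega)).2,
      show k + 1 + (b - a) = k + (b - a) + 1 by omega,
      show k - 1 + (b - a) = k + (b - a) - 1 by omega]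
    exact hi _ (by omega) (by omega)

end Walk

namespace DMG

variable {G : DMG V}

theorem InducingWalk.inducingPath {i j : V} (h : G.InducingWalk i j) : G.InducingPath i j := by
  obtain ⟨w, hv, rfl, hl, hi⟩ := h
  rw [hv.inducing_iff, hl] at hi
  generalize hf : w.first = i at hi
  have hA : ∀ c d, G.Anc c d → G.AncEither i j d → G.AncEither i j c :=
    fun c d hcd hd => hd.imp hcd.trans hcd.trans
  induction hn : w.len using Nat.strong_induction_on generalizing w with
  | _ n ih =>
    by_cases hp : w.IsPath
    · exact ⟨w, hv, hf, hl, hp, by rw [hv.inducing_iff, hf, hl]; exact hi⟩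
    have : ∃ a b, a < b ∧ b ≤ w.len ∧ w.vert a = w.vert b := by
      simp only [Walk.IsPath] at hp
      push Not at hp
      obtain ⟨a, ha, b, hb, he, hne⟩ := hp
      rcases lt_or_gt_of_ne hne with h | h
      · exact ⟨a, b, h, hb, he⟩
      · exact ⟨b, a, h, ha, he.symm⟩
    obtain ⟨a, b, hab, hb, he⟩ := this
    refine ih (w.len - (b - a)) (by omega) (w.cut a b) (hv.cut hab he) ?_ ?_
      (hi.cut hA hv hab he) rfl
    · rw [Walk.last, show (w.cut a b).len = w.len - (b - a) from rfl,
        Walk.cut_vert_of_ge hab he (by omega), ← hl, Walk.last]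
      congr 1; omega
    · rw [Walk.first, Walk.cut_vert_of_le (Nat.zero_le _)]; exact hf

theorem InducingWalk.exists_markedWalk {i j : V} (hij : i ≠ j) (h : G.InducingWalk i j) :
    ∃ l r, G.MarkedWalk (G.AncEither i j) i l j r := by
  obtain ⟨w, hv, hf, hl, hi⟩ := h
  rw [hv.inducing_iff, hf, hl] at hi
  have hlen : 0 < w.len := by
    rcases Nat.eq_zero_or_pos w.len with h | h
    · rw [Walk.last, h] at hl; exact absurd (hf.symm.trans hl) hij
    · exact h
  let mL : ℕ → EndMark := fun a => if w.intoL a then .arrow else if a = 0 then .tail else .sccTail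
  let mR : ℕ → EndMark := fun a =>
    if w.intoR a then .arrow else if a + 1 = w.len then .tail else .sccTail
  have edge : ∀ a, a < w.len → G.MarkedEdge (w.vert a) (mL a) (w.vert (a + 1)) (mR a) := by
    intro a ha
    rcases hv a ha with ⟨h1, h2, h3⟩ | ⟨h1, h2, h3⟩ | ⟨h1, h2, h3⟩
    · by_cases h0 : a = 0
      · subst h0
        simpa [mL, mR, h1, h2] using MarkedEdge.out h3
      · simpa [mL, mR, h1, h2, h0] using
          MarkedEdge.outScc h3 ((hi a (by omega) ha).2.2 h1)
    · by_cases h0 : a + 1 = w.len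
      · simpa [mL, mR, h1, h2, h0] using MarkedEdge.inn h3
      · simpa [mL, mR, h1, h2, h0] using
          MarkedEdge.innScc h3 ((hi (a + 1) (by omega) (by omega)).2.1 h2)
    · simpa [mL, mR, h1, h2] using MarkedEdge.bi h3
  have main : ∀ d a, a + d + 1 = w.len →
      G.MarkedWalk (G.AncEither i j) (w.vert a) (mL a) (w.vert w.len) (mR (w.len - 1)) := by
    intro d
    induction d with
    | zero =>
      intro a ha
      rw [show w.len - 1 = a by omega, ← show a + 1 = w.len by omega]
      exact .single (edge a (by omega))
    | succ d ih =>
      intro a ha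
      refine .cons (edge a (by omega)) ⟨?_, ?_, ?_⟩ (ih (a + 1) (by omega))
      · have : a + 1 ≠ w.len := by omega
        cases h : w.intoR a <;> simp [mR, h, this]
      · cases h : w.intoL (a + 1) <;> simp [mL, h]
      · intro h1 h2
        refine (hi (a + 1) (by omega) (by omega)).1 ?_ ?_
        · by_contra h
          simp only [Nat.add_sub_cancel] at h
          simp only [mR, h] at h1
          split_ifs at h1 <;> contradiction
        · by_contra h
          simp only [mL, h] at h2
          split_ifs at h2; contradiction
  refine ⟨mL 0, mR (w.len - 1), ?_⟩
  have := main (w.len - 1) 0 (by omega)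
  rwa [show w.vert 0 = i from hf, show w.vert w.len = j from hl] at this

theorem MarkedWalk.exists_walk {A : V → Prop} {u v : V} {l r : EndMark}
    (h : G.MarkedWalk A u l v r) : ∃ w : Walk V, w.ValidOn G ∧ w.first = u ∧ w.last = v ∧
      w.InteriorInducing G A ∧ 0 < w.len ∧ (w.intoL 0 = true ↔ l = .arrow) ∧
      (w.intoR (w.len - 1) = true ↔ r = .arrow) ∧
      (l = .sccTail → G.Scc (w.vert 0) (w.vert 1)) := by
  have edge : ∀ {u v l r}, G.MarkedEdge u l v r → ∃ bl br : Bool,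
      (bl = true ↔ l = .arrow) ∧ (br = true ↔ r = .arrow) ∧
      ((bl = false ∧ br = true ∧ G.dir u v) ∨ (bl = true ∧ br = false ∧ G.dir v u) ∨
        (bl = true ∧ br = true ∧ G.BiEdge u v)) := by
    intro u v l r e
    cases e with
    | out h => exact ⟨false, true, by simp [h]⟩
    | outScc h => exact ⟨false, true, by simp [h]⟩
    | inn h => exact ⟨true, false, by simp [h]⟩
    | innScc h => exact ⟨true, false, by simp [h]⟩
    | bi h => exact ⟨true, true, by simp [h]⟩
  induction h with
  | @single u l v r e =>
    obtain ⟨bl, br, hl, hr, he⟩ := edge e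
    refine ⟨⟨1, fun t => if t = 0 then u else v, fun _ => bl, fun _ => br⟩, ?_, rfl, rfl, ?_,
      Nat.one_pos, hl, hr, ?_⟩
    · intro k hk
      obtain rfl : k = 0 := Nat.lt_one_iff.1 hk
      exact he
    · intro k hk0 hk
      have : k < 1 := hk
      omega
    · rintro rfl
      exact e.scc
  | @cons u l x r l' y r' e ok _ ih =>
    obtain ⟨bl, br, hl, hr, he⟩ := edge e
    obtain ⟨w, hv, hf, hla, hi, hlen, hwl, hwr, hs⟩ := ih
    refine ⟨⟨w.len + 1, fun t => match t with | 0 => u | t + 1 => w.vert t,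
      fun t => match t with | 0 => bl | t + 1 => w.intoL t,
      fun t => match t with | 0 => br | t + 1 => w.intoR t⟩, ?_, rfl, hla, ?_, Nat.succ_pos _, hl, ?_, ?_⟩
    · rintro (_ | k) hk
      · rw [← hf] at he; exact he
      · exact hv k (Nat.lt_of_succ_lt_succ hk)
    · rintro (_ | _ | k) hk0 hk
      · exact absurd hk0 (lt_irrefl _)
      · refine ⟨fun h1 h2 => ?_, fun h1 => ?_, fun h1 => ?_⟩
        · change A w.first
          rw [hf]
          exact ok.2.2 (hr.1 h1) (hwl.1 h2)
        · change G.Scc w.first u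
          rw [hf]
          change br = false at h1
          have hr' : r ≠ .arrow := fun h => by simp [hr.2 h] at h1
          cases r with
          | arrow => exact absurd rfl hr'
          | tail => exact absurd rfl ok.1
          | sccTail => exact e.symm.scc
        · change w.intoL 0 = false at h1
          have hl' : l' ≠ .arrow := fun h => by simp [hwl.2 h] at h1
          cases l' with
          | arrow => exact absurd rfl hl'
          | tail => exact absurd rfl ok.2.1
          | sccTail => exact hs rfl
      · exact hi (k + 1) (Nat.succ_pos _) (Nat.lt_of_succ_lt_succ hk)
    · obtain ⟨m, hm⟩ : ∃ m, w.len = m + 1 := ⟨w.len - 1, by omega⟩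
      rw [hm] at hwr
      simp only [hm]
      exact hwr
    · rintro rfl
      change G.Scc u w.first
      rw [hf]
      exact e.scc

theorem MarkedWalk.inducingWalk {i j : V} {l r : EndMark}
    (h : G.MarkedWalk (G.AncEither i j) i l j r) : G.InducingWalk i j := by
  obtain ⟨w, hv, hf, hl, hi, -⟩ := h.exists_walk
  exact ⟨w, hv, hf, hl, by rwa [hv.inducing_iff, hf, hl]⟩

theorem MarkedWalk.inducingWalkIntoBoth {i j : V}
    (h : G.MarkedWalk (G.AncEither i j) i .arrow j .arrow) : G.InducingWalkIntoBoth i j := by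
  obtain ⟨w, hv, hf, hl, hi, hlen, h1, h2, -⟩ := h.exists_walk
  exact ⟨w, hv, hf, hl, by rwa [hv.inducing_iff, hf, hl], ⟨hlen, h1.2 rfl⟩, hlen, h2.2 rfl⟩

end DMG

namespace DPAG

open DMG

variable {P : DPAG V} {G : DMG V}

theorem ne_of_adj {a b : V} (h : P.adj a b) : a ≠ b := by
  rintro rfl; exact P.adj_irrefl _ h

theorem Contains.adj_of_markedWalk (hPG : P.Contains G) {a b : V} (hab : a ≠ b) {l r : EndMark}
    (h : G.MarkedWalk (G.AncEither a b) a l b r) : P.adj a b :=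
  (hPG.1 a b hab).2 h.inducingWalk.inducingPath

theorem Contains.exists_markedWalk (hPG : P.Contains G) {a b : V} (h : P.adj a b) :
    ∃ l r, G.MarkedWalk (G.AncEither a b) a l b r := by
  obtain ⟨w, hv, hf, hl, -, hi⟩ := (hPG.1 a b (ne_of_adj h)).1 h
  exact InducingWalk.exists_markedWalk (ne_of_adj h) ⟨w, hv, hf, hl, hi⟩

theorem Contains.markedWalk_of_arrowAt (hPG : P.Contains G) {a b : V} (h : P.ArrowAt a b) :
    ∃ l, G.MarkedWalk (G.AncEither a b) a l b .arrow := by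
  obtain ⟨l, r, hw⟩ := hPG.exists_markedWalk h.1
  exact ⟨l, hw.arrow_right_of_not_anc (hPG.2.1 a b h)⟩

theorem Contains.markedWalk_of_biEdge (hPG : P.Contains G) {a b : V} (h : P.BiEdge a b) :
    G.MarkedWalk (G.AncEither a b) a .arrow b .arrow := by
  obtain ⟨l, hw⟩ := hPG.markedWalk_of_arrowAt ⟨h.1, h.2.1⟩
  exact hw.arrow_of_not_anc (hPG.2.1 b a ⟨P.adj_symm _ _ h.1, h.2.2⟩)

/-- If an edge is definitely visible after orienting it out of `k` in agreement with the
ancestral relations of `G`, then no inducing walk in `G` between its endpoints is into `k`. -/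
theorem Contains.not_markedWalk_of_definitelyVisibleOn [DecidableEq V] (hPG : P.Contains G)
    {k j : V} (hkj : G.Anc k j)
    (hVis : DefinitelyVisibleOn P.adj
        (fun a b => if a = k ∧ b = j then Mark.arrow
          else if a = j ∧ b = k then Mark.tail else P.mark a b) k j) {r : EndMark} :
    ¬ G.MarkedWalk (fun c => G.Anc c j) k .arrow j r := by
  intro hw
  obtain ⟨hdir, x, hxj, hx⟩ := hVis
  have hkj_ne : k ≠ j := ne_of_adj hdir.1
  suffices h : x ≠ j ∧ ∃ l, G.MarkedWalk (G.AncEither x j) x l k .arrow by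
    obtain ⟨hne, l, h⟩ := h
    exact hxj (hPG.adj_of_markedWalk hne
      (h.append (.of_arrow (.inr hkj)) (hw.mono fun _ => Or.inr)))
  rcases hx with ⟨hadj, hm⟩ | ⟨n, p, hn, rfl, rfl, hp, hadj, hm, hcol⟩
  · have hne : x ≠ j := by
      rintro rfl
      simp [hkj_ne.symm] at hm
    have hm' : P.mark x k = Mark.arrow := by simpa [hne, ne_of_adj hadj] using hm
    obtain ⟨l, h⟩ := hPG.markedWalk_of_arrowAt ⟨hadj, hm'⟩
    exact ⟨hne, l, h.mono fun c => Or.imp_right fun h => h.trans hkj⟩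
  · have hne_k : ∀ m, m < n → p m ≠ p n := fun m hm h =>
      absurd (hp m hm.le n le_rfl h) hm.ne
    have hmark_eq : ∀ a b, a ≠ p n → a ≠ j →
        (if a = p n ∧ b = j then Mark.arrow
          else if a = j ∧ b = p n then Mark.tail else P.mark a b) = P.mark a b := by
      intro a b h1 h2
      simp [h1, h2]
    have hmark_eq' : ∀ a b, b ≠ p n → b ≠ j →
        (if a = p n ∧ b = j then Mark.arrow
          else if a = j ∧ b = p n then Mark.tail else P.mark a b) = P.mark a b := by
      intro a b h1 h2
      simp [h1, h2]
    have hne_j : ∀ m, 0 < m → m ≤ n → p m ≠ j := by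
      intro m h0 hmn
      rcases hmn.eq_or_lt with rfl | hlt
      · exact hkj_ne
      · exact ne_of_adj (hcol m h0 hlt).2.1
    have h0j : p 0 ≠ j := by
      intro h0
      rcases Nat.lt_or_ge 1 n with h1 | h1
      · obtain ⟨⟨ha, -⟩, -, -, hb⟩ := hcol 1 Nat.one_pos h1
        rw [Nat.sub_self, h0] at ha
        simp only at ha hb
        rw [ha] at hb
        cases hb
      · obtain rfl : n = 1 := by omega
        simp [h0, hkj_ne.symm] at hm
    have hne_j' : ∀ m, m ≤ n → p m ≠ j := by
      intro m hmn
      rcases Nat.eq_zero_or_pos m with rfl | h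
      · exact h0j
      · exact hne_j m h hmn
    have hanc : ∀ m, 0 < m → m ≤ n → G.Anc (p m) j := by
      intro m h0 hmn
      rcases hmn.eq_or_lt with rfl | hlt
      · exact hkj
      · obtain ⟨-, ha, hb, hc⟩ := hcol m h0 hlt
        refine hPG.2.2 _ _ ⟨ha, ?_, ?_⟩
        · exact (hmark_eq _ _ (hne_k m hlt) (hne_j m h0 hmn)).symm.trans hb
        · exact (hmark_eq' _ _ (hne_k m hlt) (hne_j m h0 hmn)).symm.trans hc
    have harrow : ∀ m, m < n → P.mark (p m) (p (m + 1)) = Mark.arrow := by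
      intro m hmn
      refine (hmark_eq _ _ (hne_k m hmn) (hne_j' m hmn.le)).symm.trans ?_
      rcases (Nat.succ_le_of_lt hmn).eq_or_lt with h | h
      · subst h
        simpa using hm
      · simpa using (hcol (m + 1) (Nat.succ_pos _) h).1.1
    have main : ∀ m, m < n →
        ∃ l, G.MarkedWalk (G.AncEither (p 0) j) (p 0) l (p (m + 1)) .arrow := by
      intro m
      induction m with
      | zero =>
        intro hmn
        obtain ⟨l, h⟩ := hPG.markedWalk_of_arrowAt ⟨hadj 0 hmn, harrow 0 hmn⟩
        exact ⟨l, h.mono fun c => Or.imp_right fun h => h.trans (hanc 1 Nat.one_pos hmn)⟩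
      | succ m ih =>
        intro hmn
        obtain ⟨l, h⟩ := ih (by omega)
        have hback : P.mark (p (m + 1 + 1)) (p (m + 1)) = Mark.arrow :=
          (hmark_eq' _ _ (hne_k _ hmn) (hne_j' _ hmn.le)).symm.trans
            (hcol (m + 1) (Nat.succ_pos _) hmn).1.2
        have hb := hPG.markedWalk_of_biEdge ⟨hadj _ hmn, harrow _ hmn, hback⟩
        have h1 := hanc (m + 1) (Nat.succ_pos _) hmn.le
        have h2 := hanc (m + 1 + 1) (Nat.succ_pos _) hmn
        exact ⟨l, h.append (.of_arrow (.inr h1))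
          (hb.mono fun c hc => .inr (hc.elim (fun h => h.trans h1) fun h => h.trans h2))⟩
    refine ⟨h0j, ?_⟩
    have := main (n - 1) (by omega)
    rwa [show n - 1 + 1 = n by omega] at this

end DPAG

/-- suppose `i → j` in `P`, there is no inducing walk between `i`
and `j` in `G` into both `i` and `j`, and for every vertex `k` with a possibly
directed path `⟨i,k,j⟩` in `P`, the edge `k → j` is definitely visible in the
DPAG obtained from `P` by replacing the edge between `k` and `j` by `k → j`.
Then the directed edge `i → j` is present in `G`. -/
theorem statement13 [DecidableEq V] (P : DPAG V) (G : DMG V) (hPG : P.Contains G)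
    (i j : V) (hij : i ≠ j) (hEdge : P.DirEdge i j)
    (hNoInd : ¬ G.InducingWalkIntoBoth i j)
    (hVis : ∀ k, k ≠ i → k ≠ j →
      P.adj i k → P.mark k i ≠ Mark.arrow →
      P.adj k j → P.mark j k ≠ Mark.arrow →
      DefinitelyVisibleOn P.adj
        (fun a b => if a = k ∧ b = j then Mark.arrow
          else if a = j ∧ b = k then Mark.tail else P.mark a b) k j) :
    G.dir i j := by
  have hanc : G.Anc i j := hPG.2.2 i j hEdge
  obtain ⟨l, hw⟩ := hPG.markedWalk_of_arrowAt ⟨hEdge.1, hEdge.2.1⟩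
  have hl : l ≠ .arrow := by
    rintro rfl
    exact hNoInd hw.inducingWalkIntoBoth
  cases hw with
  | single e => exact (e.dir_of_ne_arrow hl).1
  | @cons _ _ k r l' _ _ e ok hw =>
    obtain ⟨hd, hr⟩ := e.dir_of_ne_arrow hl
    by_cases hkj_ne : k = j
    · exact hkj_ne ▸ hd
    exfalso
    have hki : ¬ G.Anc k i := fun hki => hNoInd
      ((DMG.MarkedWalk.of_scc ⟨.of_dir hd, hki⟩ (DMG.ne_of_dir hd)).append
        (.of_sccTail ok.2.1) hw).inducingWalkIntoBoth
    have hA : ∀ c, G.AncEither i j c → G.Anc c j := fun c hc =>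
      hc.elim (fun h => h.trans hanc) id
    have hkj : G.Anc k j := by
      by_cases hl' : l' = .arrow
      · exact hA k (ok.2.2 hr hl')
      · rcases hw.anc_of_ne_arrow hl' with h | ⟨c, h, hc⟩
        · exact h
        · exact h.trans (hA c hc)
    obtain ⟨r', hw'⟩ := (hw.mono hA).exists_arrow ok.2.1
    have hadj_ik : P.adj i k :=
      hPG.adj_of_markedWalk (DMG.ne_of_dir hd).symm (.single (.out hd))
    have hadj_kj : P.adj k j :=
      hPG.adj_of_markedWalk hkj_ne (hw'.mono fun _ => Or.inr)
    exact hPG.not_markedWalk_of_definitelyVisibleOn hkj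
      (hVis k (DMG.ne_of_dir hd) hkj_ne hadj_ik
        (fun h => hPG.2.1 k i ⟨P.adj_symm _ _ hadj_ik, h⟩ (.of_dir hd))
        hadj_kj (fun h => hPG.2.1 j k ⟨P.adj_symm _ _ hadj_kj, h⟩ hkj)) hw'

end CausalGraphs
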